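/- arXiv:1301.3188 — 3 statements merged into one kernel-verified Lean document; each statement's English description precedes it below -/
import Mathlib

section
/- No simple permutation in 𝒜 has extreme pattern 3412: there is no simple permutation π ∈ 𝒜 of length n ≥ 4 such that the position of its maximum precedes the position of its minimum (π⁻¹(n) < π⁻¹(1)) and its first entry exceeds its last entry (π(1) > π(n)). -/
/-- `σ` is contained in `π` as a pattern. -/
def Contains {k n : ℕ} (σ : Equiv.Perm (Fin k)) (π : Equiv.Perm (Fin n)) : Prop :=
  ∃ f : Fin k → Fin n, StrictMono f ∧ ∀ i j : Fin k, σ i < σ j ↔ π (f i) < π (f j)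

/-- `π` avoids the pattern `σ`. -/
def Avoids {k n : ℕ} (σ : Equiv.Perm (Fin k)) (π : Equiv.Perm (Fin n)) : Prop :=
  ¬ Contains σ π

/-- The permutation 4231 (0-indexed values). -/
noncomputable def p4231 : Equiv.Perm (Fin 4) := Equiv.ofBijective ![3,1,2,0] (by decide)

/-- The permutation 35142 (0-indexed values). -/
noncomputable def p35142 : Equiv.Perm (Fin 5) := Equiv.ofBijective ![2,4,0,3,1] (by decide)

/-- The permutation 42513 (0-indexed values). -/
noncomputable def p42513 : Equiv.Perm (Fin 5) := Equiv.ofBijective ![3,1,4,0,2] (by decide)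

/-- The permutation 351624 (0-indexed values). -/
noncomputable def p351624 : Equiv.Perm (Fin 6) := Equiv.ofBijective ![2,4,0,5,1,3] (by decide)

/-- Membership in the class 𝒜 = Av(4231, 35142, 42513, 351624). -/
def InA {n : ℕ} (π : Equiv.Perm (Fin n)) : Prop :=
  Avoids p4231 π ∧ Avoids p35142 π ∧ Avoids p42513 π ∧ Avoids p351624 π

/-- `s` is an interval of `π`: a set of consecutive positions whose image
under `π` is a set of consecutive values. -/
def IsPermInterval {n : ℕ} (π : Equiv.Perm (Fin n)) (s : Finset (Fin n)) : Prop :=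
  (∀ a ∈ s, ∀ b ∈ s, ∀ j : Fin n, a ≤ j → j ≤ b → j ∈ s) ∧
  (∀ a ∈ s, ∀ b ∈ s, ∀ j : Fin n, π a ≤ π j → π j ≤ π b → j ∈ s)

/-- `π` is simple: its only intervals are singletons (or empty) and the whole domain. -/
def IsSimple {n : ℕ} (π : Equiv.Perm (Fin n)) : Prop :=
  ∀ s : Finset (Fin n), IsPermInterval π s → s.card ≤ 1 ∨ s = Finset.univ

/-- The reverse complement of a permutation. -/
def revComp {n : ℕ} (π : Equiv.Perm (Fin n)) : Equiv.Perm (Fin n) :=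
  (Fin.revPerm.trans π).trans Fin.revPerm

/-- The skew sum `σ ⊖ τ`. -/
def skewSum {m k : ℕ} (σ : Equiv.Perm (Fin m)) (τ : Equiv.Perm (Fin k)) :
    Equiv.Perm (Fin (m + k)) :=
  finSumFinEquiv.symm.trans ((Equiv.sumCongr σ τ).trans
    ((Equiv.sumComm (Fin m) (Fin k)).trans (finSumFinEquiv.trans (finCongr (Nat.add_comm k m)))))

/-- The direct sum `α ⊕ β`. -/
def directSum {m k : ℕ} (α : Equiv.Perm (Fin m)) (β : Equiv.Perm (Fin k)) :
    Equiv.Perm (Fin (m + k)) :=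
  finSumFinEquiv.symm.trans ((Equiv.sumCongr α β).trans finSumFinEquiv)

/-- The permutation 312 (0-indexed values). -/
noncomputable def p312 : Equiv.Perm (Fin 3) := Equiv.ofBijective ![2,0,1] (by decide)

/-- The permutation 231 (0-indexed values). -/
noncomputable def p231 : Equiv.Perm (Fin 3) := Equiv.ofBijective ![1,2,0] (by decide)

/-- The number of simple permutations of length `n` in the class 𝒜. -/
noncomputable def simpleCount (n : ℕ) : ℕ :=
  Nat.card {π : Equiv.Perm (Fin n) // IsSimple π ∧ InA π}

theorem Contains.p4231_intro {n : ℕ} {π : Equiv.Perm (Fin n)} {i j k l : Fin n}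
    (hij : i < j) (hjk : j < k) (hkl : k < l)
    (h₁ : π l < π j) (h₂ : π j < π k) (h₃ : π k < π i) : Contains p4231 π := by
  refine ⟨![i, j, k, l], ?_, ?_⟩
  · rw [Fin.strictMono_iff_lt_succ]
    intro x
    fin_cases x <;> simp <;> assumption
  · intro x y
    fin_cases x <;> fin_cases y <;> simp [p4231] <;> order

theorem Contains.p35142_intro {n : ℕ} {π : Equiv.Perm (Fin n)} {i j k l m : Fin n}
    (hij : i < j) (hjk : j < k) (hkl : k < l) (hlm : l < m)
    (h₁ : π k < π m) (h₂ : π m < π i) (h₃ : π i < π l) (h₄ : π l < π j) :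
    Contains p35142 π := by
  refine ⟨![i, j, k, l, m], ?_, ?_⟩
  · rw [Fin.strictMono_iff_lt_succ]
    intro x
    fin_cases x <;> simp <;> assumption
  · intro x y
    fin_cases x <;> fin_cases y <;> simp [p35142] <;> order

theorem Contains.p42513_intro {n : ℕ} {π : Equiv.Perm (Fin n)} {i j k l m : Fin n}
    (hij : i < j) (hjk : j < k) (hkl : k < l) (hlm : l < m)
    (h₁ : π l < π j) (h₂ : π j < π m) (h₃ : π m < π i) (h₄ : π i < π k) :
    Contains p42513 π := by
  refine ⟨![i, j, k, l, m], ?_, ?_⟩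
  · rw [Fin.strictMono_iff_lt_succ]
    intro x
    fin_cases x <;> simp <;> assumption
  · intro x y
    fin_cases x <;> fin_cases y <;> simp [p42513] <;> order

/-- A simple permutation of length at least 3 is skew-indecomposable. -/
theorem IsSimple.eq_empty_or_eq_univ_of_skew {n : ℕ} (hn : 3 ≤ n) {π : Equiv.Perm (Fin n)}
    (hπ : IsSimple π) (s : Finset (Fin n))
    (hs : ∀ i ∈ s, ∀ j ∉ s, i < j ∧ π j < π i) : s = ∅ ∨ s = Finset.univ := by
  have h₁ : IsPermInterval π s := by
    constructor
    · intro a _ b hb j _ hjb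
      by_contra hj
      exact absurd (hs b hb j hj).1 (not_lt.2 hjb)
    · intro a ha b _ j haj _
      by_contra hj
      exact absurd (hs a ha j hj).2 (not_lt.2 haj)
  have h₂ : IsPermInterval π sᶜ := by
    simp only [IsPermInterval, Finset.mem_compl]
    constructor
    · intro a ha b _ j haj _ hj
      exact absurd (hs j hj a ha).1 (not_lt.2 haj)
    · intro a _ b hb j _ hjb hj
      exact absurd (hs j hj b hb).2 (not_lt.2 hjb)
  rcases hπ s h₁ with h₁ | h₁
  · rcases hπ sᶜ h₂ with h₂ | h₂
    · have := Finset.card_add_card_compl s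
      rw [Fintype.card_fin] at this
      omega
    · exact Or.inl (by simpa using h₂)
  · exact Or.inr h₁

theorem statement_5 {n : ℕ} (hn : 4 ≤ n) (π : Equiv.Perm (Fin n))
    (hsimple : IsSimple π) (hA : InA π) :
    ¬ (π⁻¹ ⟨n - 1, by omega⟩ < π⁻¹ ⟨0, by omega⟩ ∧
        π ⟨n - 1, by omega⟩ < π ⟨0, by omega⟩) := by
  rintro ⟨hpq, hba⟩
  obtain ⟨h4231, h35142, h42513, -⟩ := hA
  set first : Fin n := ⟨0, by omega⟩ with hfirst
  set last : Fin n := ⟨n - 1, by omega⟩ with hlast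
  have first_le : ∀ i : Fin n, first ≤ i := fun i => Fin.mk_le_of_le_val (Nat.zero_le _)
  have le_last : ∀ i : Fin n, i ≤ last := fun i => by
    rw [Fin.le_def, hlast]; simp only; omega
  obtain ⟨p, hp⟩ : ∃ p, p = π⁻¹ last := ⟨_, rfl⟩
  obtain ⟨q, hq⟩ : ∃ q, q = π⁻¹ first := ⟨_, rfl⟩
  rw [← hp, ← hq] at hpq
  have hπp : ∀ i, π i ≤ π p := fun i => by simpa [hp] using le_last (π i)
  have hπq : ∀ i, π q ≤ π i := fun i => by simpa [hq] using first_le (π i)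
  have lt_of_le {i j : Fin n} (h : π i ≤ π j) (hne : i ≠ j) : π i < π j :=
    lt_of_le_of_ne h (π.injective.ne hne)
  -- No entry before the maximum lies below the last entry.
  have left_bottom : ∀ i, i ≤ p → π last ≤ π i := by
    intro i hi
    by_contra! h
    have h₁ : first ≠ i := by rintro rfl; order
    have h₂ : i ≠ p := by rintro rfl; exact absurd (hπp last) (not_le.2 h)
    have h₃ : i ≠ q := by rintro rfl; order
    have h₄ : first ≠ p := by rintro rfl; exact h₁ (le_antisymm (first_le _) hi)
    have h₅ : q ≠ last := by rintro rfl; exact absurd (hπq i) (not_le.2 h)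
    exact h42513 <| Contains.p42513_intro (lt_of_le_of_ne (first_le i) h₁) (lt_of_le_of_ne hi h₂)
      hpq (lt_of_le_of_ne (le_last q) h₅) (lt_of_le (hπq i) h₃.symm) h hba (lt_of_le (hπp _) h₄)
  -- No entry after the minimum lies above the first entry.
  have top_right : ∀ i, π first ≤ π i → i ≤ q := by
    intro i hi
    by_contra! h
    have h₁ : first ≠ i := by
      rintro rfl; exact absurd (first_le q) (not_le.2 h)
    have h₂ : i ≠ last := by rintro rfl; order
    have h₃ : i ≠ p := by rintro rfl; order
    have h₄ : first ≠ p := by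
      rintro h'; exact h₁ (π.injective (le_antisymm hi (h' ▸ hπp i)))
    have h₅ : q ≠ last := by rintro rfl; exact absurd (le_last i) (not_le.2 h)
    exact h35142 <| Contains.p35142_intro (lt_of_le_of_ne (first_le p) h₄) hpq h
      (lt_of_le_of_ne (le_last i) h₂) (lt_of_le (hπq _) h₅) hba (lt_of_le hi h₁)
      (lt_of_le (hπp i) h₃)
  have skew : ∀ i ∈ Finset.univ.filter (fun i => i ≤ p ∨ π first ≤ π i),
      ∀ j ∉ Finset.univ.filter (fun i => i ≤ p ∨ π first ≤ π i), i < j ∧ π j < π i := by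
    simp only [Finset.mem_filter, Finset.mem_univ, true_and, not_or, not_le]
    rintro i hi j ⟨hpj, hj⟩
    by_cases hip : i ≤ p
    · refine ⟨by order, ?_⟩
      by_contra! h
      have hij : i < j := by order
      have h₁ := lt_of_le h hij.ne
      have h₂ : i ≠ last := by
        rintro rfl; exact absurd (le_last j) (not_le.2 hij)
      have h₃ : π last < π i := lt_of_le (left_bottom i hip) h₂.symm
      have h₄ : j ≠ last := by rintro rfl; order
      have h₅ : first ≠ i := by rintro rfl; order
      exact h4231 <| Contains.p4231_intro (lt_of_le_of_ne (first_le i) h₅) hij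
        (lt_of_le_of_ne (le_last j) h₄) h₃ h₁ hj
    · have hi' : π first ≤ π i := hi.resolve_left hip
      have hji : π j < π i := by order
      refine ⟨?_, hji⟩
      by_contra! h
      have hne : j ≠ i := by rintro rfl; order
      have hji' : j < i := lt_of_le_of_ne h hne
      have h₁ : i ≠ q := by rintro rfl; exact absurd (hπq j) (not_le.2 hji)
      have h₂ : i < q := lt_of_le_of_ne (top_right i hi') h₁
      have h₃ : q ≠ j := by rintro rfl; order
      have h₄ : i ≠ p := by rintro rfl; order
      exact h4231 <| Contains.p4231_intro hpj hji' h₂ (lt_of_le (hπq j) h₃) hji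
        (lt_of_le (hπp i) h₄)
  rcases hsimple.eq_empty_or_eq_univ_of_skew (by omega) _ skew with h | h
  · have : first ∈ (∅ : Finset (Fin n)) := by rw [← h]; simp
    simp at this
  · have hmem : last ∈ (Finset.univ : Finset (Fin n)) := Finset.mem_univ _
    rw [← h] at hmem
    simp only [Finset.mem_filter, Finset.mem_univ, true_and] at hmem
    have := le_last q
    rcases hmem with hmem | hmem <;> order
end

section
/- Let π ∈ 𝒜 be a simple permutation of length n ≥ 4 whose extreme pattern is 2413, i.e., writing p = π⁻¹(n) and q = π⁻¹(1), one has p < q and π(1) < π(n). Then π is N-shaped: π is strictly increasing on positions 1,…,p, strictly decreasing on positions p,…,q, and strictly increasing on positions q,…,n. -/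
section Inversions

variable {α β : Type*} [LinearOrder α] [LinearOrder β]

/-- A path leaving a set has a step that leaves it. -/
theorem Relation.ReflTransGen.exists_step_leaving {γ : Type*} {r : γ → γ → Prop} {a b : γ}
    (h : Relation.ReflTransGen r a b) (P : γ → Prop) (ha : P a) (hb : ¬ P b) :
    ∃ u v, Relation.ReflTransGen r a u ∧ r u v ∧ P u ∧ ¬ P v := by
  induction h with
  | refl => exact absurd ha hb
  | @tail c d hac hcd ih =>
    by_cases hc : P c
    · exact ⟨c, d, hac, hcd, hc, hb⟩
    · exact ih hc

/-- The positions `x` and `y` before `p` form an inversion of `f`. -/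
def InvertedBefore (f : α → β) (p x y : α) : Prop :=
  x < p ∧ y < p ∧ (x < y ∧ f y < f x ∨ y < x ∧ f x < f y)

theorem InvertedBefore.symm {f : α → β} {p x y : α} (h : InvertedBefore f p x y) :
    InvertedBefore f p y x :=
  ⟨h.2.1, h.1, h.2.2.symm⟩

/-- If `f` has no nontrivial interval and avoids 4231 and 42513, and its maximum is attained at `p`
and its minimum at a later `q`, then `f` increases up to `p`. The interval that an inversion would
produce is its connected component in the inversion graph of the positions before `p`. -/
theorem lt_of_lt_of_le_argmax {f : α → β} (hf : Function.Injective f)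
    (hsimple : ∀ s : Set α,
      (∀ a ∈ s, ∀ b ∈ s, ∀ j, a ≤ j → j ≤ b → j ∈ s) →
      (∀ a ∈ s, ∀ b ∈ s, ∀ j, f a ≤ f j → f j ≤ f b → j ∈ s) →
      s.Subsingleton ∨ s = Set.univ)
    (h4231 : ∀ a b c d, a < b → b < c → c < d → f d < f b → f b < f c → f c < f a → False)
    (h42513 : ∀ a b c d e, a < b → b < c → c < d → d < e →
      f d < f b → f b < f e → f e < f a → f a < f c → False)
    {p q : α} (hp : ∀ x, f x ≤ f p) (hq : ∀ x, f q ≤ f x) (hpq : p < q)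
    {i j : α} (hij : i < j) (hjp : j ≤ p) : f i < f j := by
  by_contra hcon
  have hlt {x y : α} (hxy : x ≠ y) (h : f x ≤ f y) : f x < f y :=
    h.lt_of_ne fun e => hxy (hf e)
  have hji : f j < f i := hlt hij.ne' (not_lt.1 hcon)
  have hjp' : j < p := hjp.lt_of_ne fun e => (e ▸ hji).not_ge (hp i)
  let r := InvertedBefore f p
  let s : Set α := {x | Relation.ReflTransGen r i x}
  have : Std.Symm r := ⟨fun _ _ h => h.symm⟩
  have hconn {a b : α} (ha : a ∈ s) (hb : b ∈ s) : Relation.ReflTransGen r a b :=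
    (symm_of (Relation.ReflTransGen r) ha).trans hb
  have hsp {x : α} (hx : x ∈ s) : x < p := by
    rcases Relation.ReflTransGen.cases_tail hx with h | ⟨c, -, h⟩
    · exact h ▸ hij.trans hjp'
    · exact h.2.1
  have hadj {x y : α} (hx : x ∈ s) (hxy : r x y) : y ∈ s := Relation.ReflTransGen.tail hx hxy
  have hpos : ∀ a ∈ s, ∀ b ∈ s, ∀ j, a ≤ j → j ≤ b → j ∈ s := by
    intro a ha b hb k hak hkb
    rcases hkb.eq_or_lt with rfl | hkb
    · exact hb
    obtain ⟨u, v, hau, huv, huk, hkv⟩ :=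
      (hconn ha hb).exists_step_leaving (· ≤ k) hak (not_le.2 hkb)
    have hu : u ∈ s := Relation.ReflTransGen.trans ha hau
    have hv : v ∈ s := hadj hu huv
    replace hkv : k < v := not_le.1 hkv
    have hkp : k < p := hkv.trans (hsp hv)
    rcases huk.eq_or_lt with rfl | huk
    · exact hu
    have hfvu : f v < f u := huv.2.2.resolve_right (fun h => (huk.trans hkv).not_gt h.1) |>.2
    rcases lt_or_ge (f k) (f u) with h | h
    · exact hadj hu ⟨hsp hu, hkp, Or.inl ⟨huk, h⟩⟩
    · exact hadj hv ⟨hsp hv, hkp, Or.inr ⟨hkv, hfvu.trans_le h⟩⟩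
  have hval : ∀ a ∈ s, ∀ b ∈ s, ∀ j, f a ≤ f j → f j ≤ f b → j ∈ s := by
    intro a ha b hb k hak hkb
    rcases hkb.eq_or_lt with hkb | hkb
    · exact hf hkb ▸ hb
    obtain ⟨u, v, hau, huv, huk, hkv⟩ :=
      (hconn ha hb).exists_step_leaving (fun x => f x ≤ f k) hak (not_le.2 hkb)
    have hu : u ∈ s := Relation.ReflTransGen.trans ha hau
    have hv : v ∈ s := hadj hu huv
    replace hkv : f k < f v := not_le.1 hkv
    rcases eq_or_ne u k with rfl | hne
    · exact hu
    replace huk : f u < f k := hlt hne huk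
    have hvu : v < u := huv.2.2.resolve_left (fun h => (huk.trans hkv).not_gt h.2) |>.1
    have hup : u < p := hsp hu
    have hqu : f q < f u := hlt (hup.trans hpq).ne' (hq u)
    rcases lt_trichotomy k p with hkp | rfl | hpk
    · rcases lt_or_ge k u with h | h
      · exact hadj hu ⟨hup, hkp, Or.inr ⟨h, huk⟩⟩
      · exact hadj hv ⟨hsp hv, hkp, Or.inl ⟨hvu.trans_le h, hkv⟩⟩
    · exact absurd (hp v) hkv.not_ge
    · rcases lt_trichotomy k q with hkq | rfl | hqk
      · exact (h4231 v u k q hvu (hup.trans hpk) hkq hqu huk hkv).elim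
      · exact absurd (hq u) huk.not_ge
      · exact (h42513 v u p q k hvu hup hpq hqk hqu huk hkv (hlt (hsp hv).ne (hp v))).elim
  have hi : i ∈ s := Relation.ReflTransGen.refl
  rcases hsimple s hpos hval with h | h
  · exact hij.ne (h hi (hadj hi ⟨hij.trans hjp', hjp', Or.inl ⟨hij, hji⟩⟩))
  · exact lt_irrefl p (hsp (h ▸ Set.mem_univ p))

end Inversions

section Patterns

variable {n : ℕ} {π : Equiv.Perm (Fin n)}

theorem Avoids.not_4231 (h : Avoids p4231 π) (a b c d : Fin n) (hab : a < b) (hbc : b < c)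
    (hcd : c < d) (hdb : π d < π b) (hbc' : π b < π c) (hca : π c < π a) : False := by
  refine h ⟨![a, b, c, d], ?_, ?_⟩
  · rw [Fin.strictMono_iff_lt_succ]
    intro i
    fin_cases i <;> assumption
  · intro i j
    fin_cases i <;> fin_cases j <;> simp [p4231] <;> order

theorem Avoids.not_42513 (h : Avoids p42513 π) (a b c d e : Fin n) (hab : a < b) (hbc : b < c)
    (hcd : c < d) (hde : d < e) (hdb : π d < π b) (hbe : π b < π e) (hea : π e < π a)
    (hac : π a < π c) : False := by
  refine h ⟨![a, b, c, d, e], ?_, ?_⟩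
  · rw [Fin.strictMono_iff_lt_succ]
    intro i
    fin_cases i <;> assumption
  · intro i j
    fin_cases i <;> fin_cases j <;> simp [p42513] <;> order

theorem Avoids.not_35142 (h : Avoids p35142 π) (a b c d e : Fin n) (hab : a < b) (hbc : b < c)
    (hcd : c < d) (hde : d < e) (hce : π c < π e) (hea : π e < π a) (had : π a < π d)
    (hdb : π d < π b) : False := by
  refine h ⟨![a, b, c, d, e], ?_, ?_⟩
  · rw [Fin.strictMono_iff_lt_succ]
    intro i
    fin_cases i <;> assumption
  · intro i j
    fin_cases i <;> fin_cases j <;> simp [p35142] <;> order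

theorem IsSimple.subsingleton_or_eq_univ (h : IsSimple π) (s : Set (Fin n))
    (hpos : ∀ a ∈ s, ∀ b ∈ s, ∀ j, a ≤ j → j ≤ b → j ∈ s)
    (hval : ∀ a ∈ s, ∀ b ∈ s, ∀ j, π a ≤ π j → π j ≤ π b → j ∈ s) :
    s.Subsingleton ∨ s = Set.univ := by
  classical
  rcases h s.toFinset (by simpa [IsPermInterval] using ⟨hpos, hval⟩) with h | h
  · left
    intro a ha b hb
    exact Finset.card_le_one.1 h a (by simpa using ha) b (by simpa using hb)
  · exact Or.inr (Set.toFinset_eq_univ.1 h)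

end Patterns

theorem statement_6 {n : ℕ} (hn : 4 ≤ n) (π : Equiv.Perm (Fin n))
    (hsimple : IsSimple π) (hA : InA π) (p q : Fin n)
    (hp : p = π⁻¹ ⟨n - 1, by omega⟩) (hq : q = π⁻¹ ⟨0, by omega⟩)
    (hpq : p < q) (hext : π ⟨0, by omega⟩ < π ⟨n - 1, by omega⟩) :
    (∀ i j : Fin n, i < j → j ≤ p → π i < π j) ∧
    (∀ i j : Fin n, p ≤ i → i < j → j ≤ q → π j < π i) ∧
    (∀ i j : Fin n, q ≤ i → i < j → π i < π j) := by
  obtain ⟨h4231, h35142, h42513, -⟩ := hA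
  have hmax (x : Fin n) : π x ≤ π p := by
    subst hp
    rw [Equiv.Perm.inv_def, Equiv.apply_symm_apply, Fin.le_def]
    exact Nat.le_sub_one_of_lt (π x).isLt
  have hmin (x : Fin n) : π q ≤ π x := by
    subst hq
    rw [Equiv.Perm.inv_def, Equiv.apply_symm_apply, Fin.le_def]
    exact Nat.zero_le _
  have hlt {x y : Fin n} (hxy : x ≠ y) (h : π x ≤ π y) : π x < π y :=
    h.lt_of_ne fun e => hxy (π.injective e)
  refine ⟨fun i j hij hjp => ?_, fun i j hpi hij hjq => ?_, fun i j hqi hij => ?_⟩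
  · exact lt_of_lt_of_le_argmax π.injective hsimple.subsingleton_or_eq_univ h4231.not_4231
      h42513.not_42513 hmax hmin hpq hij hjp
  · by_contra hcon
    have hij' : π i < π j := hlt hij.ne (not_lt.1 hcon)
    have hpi' : p < i := hpi.lt_of_ne fun e => (e ▸ hij').not_ge (hmax j)
    have hjq' : j < q := hjq.lt_of_ne fun e => (e ▸ hij').not_ge (hmin i)
    exact h4231.not_4231 p i j q hpi' hij hjq' (hlt (hij.trans hjq').ne' (hmin i)) hij'
      (hlt (hpi'.trans hij).ne' (hmax j))
  · exact lt_of_lt_of_le_argmax (α := (Fin n)ᵒᵈ) (β := (Fin n)ᵒᵈ)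
      (f := fun x => OrderDual.toDual (π (OrderDual.ofDual x)))
      (p := OrderDual.toDual q) (q := OrderDual.toDual p)
      (i := OrderDual.toDual j) (j := OrderDual.toDual i) π.injective
      (fun s hpos hval => hsimple.subsingleton_or_eq_univ s
        (fun a ha b hb k hak hkb => hpos b hb a ha k hkb hak)
        (fun a ha b hb k hak hkb => hval b hb a ha k hkb hak))
      (fun a b c d hab hbc hcd hdb hbc' hca =>
        h4231.not_4231 d c b a hcd hbc hab hca hbc' hdb)
      (fun a b c d e hab hbc hcd hde hdb hbe hea hac =>
        h35142.not_35142 e d c b a hde hcd hbc hab hac hea hbe hdb)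
      hmin hmax hpq hij hqi
end

section
/- Let π ∈ 𝒜 be a simple permutation of length n ≥ 4 whose extreme pattern is 3142, i.e., π⁻¹(1) < π⁻¹(n) and π(1) > π(n). Then π is S-shaped: the inverse π⁻¹ is strictly increasing on the values 1,…,π(n), strictly decreasing on the values π(n),…,π(1), and strictly increasing on the values π(1),…,n. Equivalently, the entries with values from 1 to π(n) appear in increasing order of position as values increase, those with values from π(n) to π(1) in decreasing order of position, and those with values from π(1) to n in increasing order of position. -/
theorem Contains.of_p4231 {n : ℕ} {π : Equiv.Perm (Fin n)} {a b c d : Fin n}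
    (hab : a < b) (hbc : b < c) (hcd : c < d)
    (hdb : π d < π b) (hbc' : π b < π c) (hca : π c < π a) : Contains p4231 π := by
  refine ⟨![a, b, c, d], ?_, ?_⟩
  · rw [Fin.strictMono_iff_lt_succ]
    intro i
    fin_cases i <;> assumption
  · intro i j
    fin_cases i <;> fin_cases j <;> simp [p4231] <;> order

theorem Contains.of_p35142 {n : ℕ} {π : Equiv.Perm (Fin n)} {a b c d e : Fin n}
    (hab : a < b) (hbc : b < c) (hcd : c < d) (hde : d < e)
    (hce : π c < π e) (hea : π e < π a) (had : π a < π d) (hdb : π d < π b) :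
    Contains p35142 π := by
  refine ⟨![a, b, c, d, e], ?_, ?_⟩
  · rw [Fin.strictMono_iff_lt_succ]
    intro i
    fin_cases i <;> assumption
  · intro i j
    fin_cases i <;> fin_cases j <;> simp [p35142] <;> order

theorem Contains.of_p42513 {n : ℕ} {π : Equiv.Perm (Fin n)} {a b c d e : Fin n}
    (hab : a < b) (hbc : b < c) (hcd : c < d) (hde : d < e)
    (hdb : π d < π b) (hbe : π b < π e) (hea : π e < π a) (hac : π a < π c) :
    Contains p42513 π := by
  refine ⟨![a, b, c, d, e], ?_, ?_⟩
  · rw [Fin.strictMono_iff_lt_succ]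
    intro i
    fin_cases i <;> assumption
  · intro i j
    fin_cases i <;> fin_cases j <;> simp [p42513] <;> order

/-- In a simple permutation, a value-convex proper set of entries such that every inversion
inside it spans only entries of the set is increasing. Otherwise the sum component containing
its leftmost inversion would be a proper interval. -/
theorem IsSimple.lt_of_convex {n : ℕ} {π : Equiv.Perm (Fin n)} (hπ : IsSimple π)
    (L : Set (Fin n))
    (hconv : ∀ a ∈ L, ∀ b ∈ L, ∀ j, π a ≤ π j → π j ≤ π b → j ∈ L)
    (hspan : ∀ i ∈ L, ∀ j ∈ L, π j < π i → ∀ c, i < c → c < j → c ∈ L)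
    (hne : ∃ k, k ∉ L) {i j : Fin n} (hi : i ∈ L) (hj : j ∈ L) (hij : i < j) :
    π i < π j := by
  classical
  by_contra hcon
  have hinv : π j < π i := lt_of_le_of_ne (not_lt.mp hcon) fun h => hij.ne' (π.injective h)
  let tops : Finset (Fin n) := {p | p ∈ L ∧ ∃ q ∈ L, p < q ∧ π q < π p}
  have htops : tops.Nonempty := ⟨i, by simpa [tops] using ⟨hi, j, hj, hij, hinv⟩⟩
  obtain ⟨p, hp, hmin⟩ := tops.exists_min_image id htops
  simp only [tops, Finset.mem_filter, Finset.mem_univ, true_and, id] at hp hmin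
  obtain ⟨hpL, q, hqL, hpq, hqp⟩ := hp
  let s : Finset (Fin n) :=
    {k | k ∈ L ∧ p ≤ k ∧ ∀ c, p ≤ c → c < k → ∃ x ∈ L, ∃ y ∈ L, x ≤ c ∧ c < y ∧ π y < π x}
  have hs : ∀ k, k ∈ s ↔ k ∈ L ∧ p ≤ k ∧
      ∀ c, p ≤ c → c < k → ∃ x ∈ L, ∃ y ∈ L, x ≤ c ∧ c < y ∧ π y < π x := by
    simp [s]
  have hint : IsPermInterval π s := by
    constructor
    · intro a ha b hb k hak hkb
      rcases hkb.eq_or_lt with rfl | hkb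
      · exact hb
      rw [hs] at ha hb ⊢
      have hpk := ha.2.1.trans hak
      refine ⟨?_, hpk, fun c hpc hck => hb.2.2 c hpc (hck.trans hkb)⟩
      obtain ⟨x, hx, y, hy, hxk, hky, hyx⟩ := hb.2.2 k hpk hkb
      rcases hxk.eq_or_lt with rfl | hxk
      · exact hx
      · exact hspan x hx y hy hyx k hxk hky
    · intro a ha b hb k hak hkb
      rw [hs] at ha hb ⊢
      have hk : k ∈ L := hconv a ha.1 b hb.1 k hak hkb
      refine ⟨hk, ?_, fun c hpc hck => ?_⟩
      · by_contra hkp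
        have hka : k < a := (not_le.mp hkp).trans_le ha.2.1
        exact hkp (hmin k ⟨hk, a, ha.1, hka, hak.lt_of_ne fun h => hka.ne' (π.injective h)⟩)
      · rcases lt_or_ge c b with hcb | hbc
        · exact hb.2.2 c hpc hcb
        · have hbk : b < k := hbc.trans_lt hck
          exact ⟨b, hb.1, k, hk, hbc, hck, hkb.lt_of_ne fun h => hbk.ne' (π.injective h)⟩
  have hps : p ∈ s := (hs p).2 ⟨hpL, le_rfl, fun c hpc hcp => absurd hcp hpc.not_gt⟩
  have hqs : q ∈ s :=
    (hs q).2 ⟨hqL, hpq.le, fun c hpc hcq => ⟨p, hpL, q, hqL, hpc, hcq, hqp⟩⟩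
  rcases hπ s hint with h | h
  · exact hpq.ne (Finset.card_le_one.mp h p hps q hqs)
  · obtain ⟨k, hk⟩ := hne
    exact hk ((hs k).1 (h ▸ Finset.mem_univ k)).1

theorem statement_7 {n : ℕ} (hn : 4 ≤ n) (π : Equiv.Perm (Fin n))
    (hsimple : IsSimple π) (hA : InA π)
    (hpos : π⁻¹ ⟨0, by omega⟩ < π⁻¹ ⟨n - 1, by omega⟩)
    (hval : π ⟨n - 1, by omega⟩ < π ⟨0, by omega⟩) :
    (∀ u v : Fin n, u < v → v ≤ π ⟨n - 1, by omega⟩ → π⁻¹ u < π⁻¹ v) ∧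
    (∀ u v : Fin n, π ⟨n - 1, by omega⟩ ≤ u → u < v → v ≤ π ⟨0, by omega⟩ → π⁻¹ v < π⁻¹ u) ∧
    (∀ u v : Fin n, π ⟨0, by omega⟩ ≤ u → u < v → π⁻¹ u < π⁻¹ v) := by
  obtain ⟨h4231, h35142, h42513, -⟩ := hA
  generalize_proofs h0 hlast at *
  set first : Fin n := ⟨0, h0⟩
  set last : Fin n := ⟨n - 1, hlast⟩
  have first_le (i : Fin n) : first ≤ i := Fin.le_def.2 (Nat.zero_le _)
  have le_last (i : Fin n) : i ≤ last := Fin.le_def.2 (Nat.le_sub_one_of_lt i.isLt)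
  have lt_of_val_ne {i : Fin n} (h : π i ≠ π first) : first < i :=
    (first_le i).lt_of_ne fun e => h (e ▸ rfl)
  have lt_last_of_val_ne {i : Fin n} (h : π i ≠ π last) : i < last :=
    (le_last i).lt_of_ne fun e => h (e ▸ rfl)
  have low {i j : Fin n} (hi : π i < π last) (hj : π j < π last) (hij : i < j) :
      π i < π j := by
    refine hsimple.lt_of_convex {k | π k < π last}
      (fun _ _ b hb k _ hkb => lt_of_le_of_lt hkb hb) ?_ ⟨first, hval.not_gt⟩ hi hj hij
    intro x (hx : π x < π last) y (hy : π y < π last) hyx c hxc hcy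
    by_contra hc
    have hcl : π last ≤ π c := not_lt.mp hc
    have hfx : first < x := lt_of_val_ne (hx.trans hval).ne
    have hcf : π c ≠ π first := fun e => (hfx.trans hxc).ne' (π.injective e)
    rcases hcf.lt_or_gt with h | h
    · exact h4231 (.of_p4231 hfx hxc hcy hyx (hx.trans_le hcl) h)
    · exact h42513 (.of_p42513 hfx hxc hcy (lt_last_of_val_ne hy.ne) hyx hx hval h)
  have high {i j : Fin n} (hi : π first < π i) (hj : π first < π j) (hij : i < j) :
      π i < π j := by
    refine hsimple.lt_of_convex {k | π first < π k}
      (fun a ha _ _ k hak _ => lt_of_lt_of_le ha hak) ?_ ⟨last, hval.not_gt⟩ hi hj hij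
    intro x (hx : π first < π x) y (hy : π first < π y) hyx c hxc hcy
    by_contra hc
    have hcf : π c ≤ π first := not_lt.mp hc
    have hyl : y < last := lt_last_of_val_ne (hval.trans hy).ne'
    have hcl : π c ≠ π last := fun e => (hcy.trans hyl).ne (π.injective e)
    rcases hcl.lt_or_gt with h | h
    · exact h35142 (.of_p35142 (lt_of_val_ne hx.ne') hxc hcy hyl h hval hy hyx)
    · exact h4231 (.of_p4231 hxc hcy hyl h (hcf.trans_lt hy) hyx)
  refine ⟨fun u v huv hv => ?_, fun u v hu huv hv => ?_, fun u v hu huv => ?_⟩ <;>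
    obtain ⟨i, rfl⟩ := π.surjective u <;> obtain ⟨j, rfl⟩ := π.surjective v <;>
    simp only [Equiv.Perm.inv_def, Equiv.symm_apply_apply]
  · by_contra! hji
    have hji : j < i := hji.lt_of_ne fun e => huv.ne (e ▸ rfl)
    rcases hv.eq_or_lt with e | hv
    · exact (π.injective e ▸ hji).not_ge (le_last i)
    · exact (low hv (huv.trans hv) hji).not_gt huv
  · by_contra! hij
    have hij : i < j := hij.lt_of_ne fun e => huv.ne (e ▸ rfl)
    have hil : π i ≠ π last := fun e => (π.injective e ▸ hij).not_ge (le_last j)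
    have hjf : π j ≠ π first := fun e => (π.injective e ▸ hij).not_ge (first_le i)
    exact h4231 (.of_p4231 (lt_of_val_ne (huv.trans_le hv).ne) hij
      (lt_last_of_val_ne (hu.trans_lt huv).ne') (hu.lt_of_ne' hil) huv (hv.lt_of_ne hjf))
  · by_contra! hji
    have hji : j < i := hji.lt_of_ne fun e => huv.ne (e ▸ rfl)
    rcases hu.eq_or_lt with e | hu
    · exact (π.injective e ▸ hji).not_ge (first_le j)
    · exact (high (hu.trans huv) hu hji).not_gt huv
end
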